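/- For every integer l ≥ 1 there is exactly one bijection F : B_l × B₁ → B₁ × B_l that intertwines the Kashiwara operators on the tensor products (i.e. for every u ∈ B_l × B₁ and i ∈ {0,1}: ẽ_i u = 0 iff ẽ_i(F u) = 0 and F(ẽ_i u) = ẽ_i(F u) when nonzero, and likewise for f̃_i), namely the map R given by the explicit case list. -/

import Mathlib

/-- Membership in the `U_q'(A₂⁽²⁾)` crystal `B_l = {(x,y) : x ≥ 0, y ≥ 0, x+y ≤ l}`. -/
def memB (l : ℤ) (b : ℤ × ℤ) : Prop := 0 ≤ b.1 ∧ 0 ≤ b.2 ∧ b.1 + b.2 ≤ l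

instance (l : ℤ) (b : ℤ × ℤ) : Decidable (memB l b) := by unfold memB; infer_instance

/-- Raw (unconstrained) action of the Kashiwara operator `ẽ_i` (`i = 0` or `i = 1`). -/
def eraw (i : ℕ) (b : ℤ × ℤ) : ℤ × ℤ :=
  if i = 0 then (if b.2 < b.1 then (b.1 - 1, b.2) else (b.1, b.2 + 1))
  else (b.1 + 1, b.2 - 1)

/-- Raw (unconstrained) action of the Kashiwara operator `f̃_i` (`i = 0` or `i = 1`). -/
def fraw (i : ℕ) (b : ℤ × ℤ) : ℤ × ℤ :=
  if i = 0 then (if b.2 ≤ b.1 then (b.1 + 1, b.2) else (b.1, b.2 - 1))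
  else (b.1 - 1, b.2 + 1)

/-- `ẽ_i : B_l → B_l ⊔ {0}`, with `0` modelled by `none`. -/
def eop (l : ℤ) (i : ℕ) (b : ℤ × ℤ) : Option (ℤ × ℤ) :=
  if memB l (eraw i b) then some (eraw i b) else none

/-- `f̃_i : B_l → B_l ⊔ {0}`, with `0` modelled by `none`. -/
def fop (l : ℤ) (i : ℕ) (b : ℤ × ℤ) : Option (ℤ × ℤ) :=
  if memB l (fraw i b) then some (fraw i b) else none

/-- `k`-fold iterate of a partially defined map. -/
def iterOp (f : ℤ × ℤ → Option (ℤ × ℤ)) : ℕ → ℤ × ℤ → Option (ℤ × ℤ)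
  | 0, b => some b
  | k + 1, b => (iterOp f k b).bind f

/-- `ε_i(b) = max {k ≥ 0 : ẽ_iᵏ b ≠ 0}`. -/
noncomputable def eps (l : ℤ) (i : ℕ) (b : ℤ × ℤ) : ℕ :=
  sSup {k : ℕ | iterOp (eop l i) k b ≠ none}

/-- `φ_i(b) = max {k ≥ 0 : f̃_iᵏ b ≠ 0}`. -/
noncomputable def phi (l : ℤ) (i : ℕ) (b : ℤ × ℤ) : ℕ :=
  sSup {k : ℕ | iterOp (fop l i) k b ≠ none}

/-- Kashiwara tensor product rule for `ẽ_i` on `B_{l1} ⊗ B_{l2}`: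
`ẽ_i(b ⊗ b′) = (ẽ_i b) ⊗ b′` if `φ_i(b) ≥ ε_i(b′)`, and `b ⊗ (ẽ_i b′)` otherwise. -/
noncomputable def teop (l1 l2 : ℤ) (i : ℕ) (p : (ℤ × ℤ) × (ℤ × ℤ)) :
    Option ((ℤ × ℤ) × (ℤ × ℤ)) :=
  if eps l2 i p.2 ≤ phi l1 i p.1 then (eop l1 i p.1).map (fun b => (b, p.2))
  else (eop l2 i p.2).map (fun b' => (p.1, b'))

/-- Kashiwara tensor product rule for `f̃_i` on `B_{l1} ⊗ B_{l2}`: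
`f̃_i(b ⊗ b′) = (f̃_i b) ⊗ b′` if `φ_i(b) > ε_i(b′)`, and `b ⊗ (f̃_i b′)` otherwise. -/
noncomputable def tfop (l1 l2 : ℤ) (i : ℕ) (p : (ℤ × ℤ) × (ℤ × ℤ)) :
    Option ((ℤ × ℤ) × (ℤ × ℤ)) :=
  if eps l2 i p.2 < phi l1 i p.1 then (fop l1 i p.1).map (fun b => (b, p.2))
  else (fop l2 i p.2).map (fun b' => (p.1, b'))

/-- The element `1 = (1,0)` of `B₁`. -/
def one : ℤ × ℤ := (1, 0)
/-- The element `2 = (0,0)` of `B₁`. -/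
def two : ℤ × ℤ := (0, 0)
/-- The element `3 = (0,1)` of `B₁`. -/
def three : ℤ × ℤ := (0, 1)

/-- The combinatorial `R` matrix `B_l ⊗ B₁ ≃ B₁ ⊗ B_l` of `U_q'(A₂⁽²⁾)`,
given by the explicit case list. -/
def Rmat (l : ℤ) (p : (ℤ × ℤ) × (ℤ × ℤ)) : (ℤ × ℤ) × (ℤ × ℤ) :=
  let x := p.1.1
  let y := p.1.2
  if p.2 = one then
    if p.1 = (l, 0) then (one, (l, 0))
    else if x + y = l ∧ 1 ≤ y then (three, (x + 1, y - 1))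
    else if x + y = l - 1 then (two, (x + 1, y))
    else (one, (x + 1, y + 1))
  else if p.2 = two then
    if p.1 = (l, 0) then (one, (l - 1, 0))
    else if x + y = l ∧ 1 ≤ y then (three, (x, y - 1))
    else (two, (x, y))
  else
    if p.1 = (0, l) then (three, (0, l))
    else if p.1 = (0, l - 1) then (two, (0, l))
    else if p.1 = (1, 0) then (one, (0, 1))
    else if y = 0 ∧ 2 ≤ x ∧ x ≤ l then (one, (x - 2, y))
    else if x = 0 ∧ 0 ≤ y ∧ y ≤ l - 2 then (one, (x, y + 2))
    else (three, (x - 1, y - 1))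

/-- A map `F` is an isomorphism `B_l ⊗ B₁ ≃ B₁ ⊗ B_l`: a bijection between the two sets
intertwining the Kashiwara operators of the tensor products. -/
def IsCrystalIso (l : ℤ) (F : (ℤ × ℤ) × (ℤ × ℤ) → (ℤ × ℤ) × (ℤ × ℤ)) : Prop :=
  Set.BijOn F {p | memB l p.1 ∧ memB 1 p.2} {p | memB 1 p.1 ∧ memB l p.2} ∧
  ∀ p : (ℤ × ℤ) × (ℤ × ℤ), memB l p.1 ∧ memB 1 p.2 → ∀ i : ℕ, i = 0 ∨ i = 1 →
    (teop l 1 i p = none ↔ teop 1 l i (F p) = none) ∧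
    (∀ q, teop l 1 i p = some q → teop 1 l i (F p) = some (F q)) ∧
    (tfop l 1 i p = none ↔ tfop 1 l i (F p) = none) ∧
    (∀ q, tfop l 1 i p = some q → tfop 1 l i (F p) = some (F q))

/-- Closed form of `ε_i`. -/
def gE (l : ℤ) (i : ℕ) (b : ℤ × ℤ) : ℤ :=
  if i = 0 then (if b.1 ≤ b.2 then l - b.1 - b.2 else l + b.1 - 3 * b.2) else b.2

/-- Closed form of `φ_i`. -/
def gF (l : ℤ) (i : ℕ) (b : ℤ × ℤ) : ℤ :=
  if i = 0 then (if b.2 ≤ b.1 then l - b.1 - b.2 else l + b.2 - 3 * b.1) else b.1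

theorem iter_aux (P : ℤ × ℤ → Prop) (f : ℤ × ℤ → Option (ℤ × ℤ)) (g : ℤ × ℤ → ℤ)
    (h0 : ∀ b, P b → 0 ≤ g b)
    (hs : ∀ b c, P b → f b = some c → P c ∧ g c = g b - 1)
    (hn : ∀ b, P b → f b = none → g b = 0) (b : ℤ × ℤ) (hb : P b) (k : ℕ) :
    ((k : ℤ) ≤ g b → ∃ c, iterOp f k b = some c ∧ P c ∧ g c = g b - k) ∧
    (g b < k → iterOp f k b = none) := by
  induction k with
  | zero =>
    refine ⟨fun _ => ⟨b, rfl, hb, by simp⟩, fun h => ?_⟩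
    have := h0 b hb
    simp at h; omega
  | succ k ih =>
    refine ⟨fun h => ?_, fun h => ?_⟩
    · push_cast at h
      obtain ⟨c, hc, hP, hg⟩ := ih.1 (by omega)
      cases hfc : f c with
      | none => have := hn c hP hfc; omega
      | some d =>
        obtain ⟨h1, h2⟩ := hs c d hP hfc
        exact ⟨d, by simp [iterOp, hc, hfc], h1, by push_cast; omega⟩
    · push_cast at h
      by_cases hk : g b < k
      · simp [iterOp, ih.2 hk]
      · obtain ⟨c, hc, hP, hg⟩ := ih.1 (by omega)
        cases hfc : f c with
        | none => simp [iterOp, hc, hfc]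
        | some d =>
          obtain ⟨h1, h2⟩ := hs c d hP hfc
          have := h0 d h1
          omega

theorem sup_aux (P : ℤ × ℤ → Prop) (f : ℤ × ℤ → Option (ℤ × ℤ)) (g : ℤ × ℤ → ℤ)
    (h0 : ∀ b, P b → 0 ≤ g b)
    (hs : ∀ b c, P b → f b = some c → P c ∧ g c = g b - 1)
    (hn : ∀ b, P b → f b = none → g b = 0) (b : ℤ × ℤ) (hb : P b) :
    ((sSup {k : ℕ | iterOp f k b ≠ none} : ℕ) : ℤ) = g b := by
  have hS : {k : ℕ | iterOp f k b ≠ none} = Set.Iic (g b).toNat := by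
    ext k
    have h := iter_aux P f g h0 hs hn b hb k
    have := h0 b hb
    simp only [Set.mem_ofPred_eq, Set.mem_Iic]
    constructor
    · intro hk
      by_contra hc
      exact hk (h.2 (by omega))
    · intro hk
      obtain ⟨c, hc, -⟩ := h.1 (by omega)
      simp [hc]
  rw [hS, csSup_Iic]
  exact Int.toNat_of_nonneg (h0 b hb)

theorem eps_eq (l : ℤ) (i : ℕ) (b : ℤ × ℤ) (hb : memB l b) : (eps l i b : ℤ) = gE l i b := by
  refine sup_aux (memB l) (eop l i) (gE l i) ?_ ?_ ?_ b hb
  · rintro ⟨x, y⟩ h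
    simp only [memB, gE] at *
    split_ifs <;> omega
  · rintro ⟨x, y⟩ ⟨x', y'⟩ h
    simp only [memB, gE, eop, eraw] at *
    split_ifs <;> simp <;> omega
  · rintro ⟨x, y⟩ h
    simp only [memB, gE, eop, eraw] at *
    split_ifs <;> simp at * <;> omega

theorem phi_eq (l : ℤ) (i : ℕ) (b : ℤ × ℤ) (hb : memB l b) : (phi l i b : ℤ) = gF l i b := by
  refine sup_aux (memB l) (fop l i) (gF l i) ?_ ?_ ?_ b hb
  · rintro ⟨x, y⟩ h
    simp only [memB, gF] at *
    split_ifs <;> omega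
  · rintro ⟨x, y⟩ ⟨x', y'⟩ h
    simp only [memB, gF, fop, fraw] at *
    split_ifs <;> simp <;> omega
  · rintro ⟨x, y⟩ h
    simp only [memB, gF, fop, fraw] at *
    split_ifs <;> simp at * <;> omega

theorem teop_eq (l1 l2 : ℤ) (i : ℕ) (a b : ℤ × ℤ) (ha : memB l1 a) (hb : memB l2 b) :
    teop l1 l2 i (a, b) = if gE l2 i b ≤ gF l1 i a then
      (if memB l1 (eraw i a) then some (eraw i a, b) else none)
      else (if memB l2 (eraw i b) then some (a, eraw i b) else none) := by
  have h : (eps l2 i b ≤ phi l1 i a) ↔ gE l2 i b ≤ gF l1 i a := by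
    rw [← eps_eq l2 i b hb, ← phi_eq l1 i a ha]; omega
  simp only [teop, h, eop]
  split_ifs <;> rfl

theorem tfop_eq (l1 l2 : ℤ) (i : ℕ) (a b : ℤ × ℤ) (ha : memB l1 a) (hb : memB l2 b) :
    tfop l1 l2 i (a, b) = if gE l2 i b < gF l1 i a then
      (if memB l1 (fraw i a) then some (fraw i a, b) else none)
      else (if memB l2 (fraw i b) then some (a, fraw i b) else none) := by
  have h : (eps l2 i b < phi l1 i a) ↔ gE l2 i b < gF l1 i a := by
    rw [← eps_eq l2 i b hb, ← phi_eq l1 i a ha]; omega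
  simp only [tfop, h, fop]
  split_ifs <;> rfl

theorem memB_one (b : ℤ × ℤ) (h : memB 1 b) : b = (1, 0) ∨ b = (0, 0) ∨ b = (0, 1) := by
  obtain ⟨x, y⟩ := b
  simp only [memB] at h
  simp only [Prod.mk.injEq]
  omega

theorem Rmat_cases (l x y : ℤ) (b : ℤ × ℤ) (hl : 1 ≤ l) (h1 : memB l (x, y)) (h2 : memB 1 b) :
    (b = (1, 0) ∧ (x = l ∧ y = 0) ∧ Rmat l ((x, y), b) = ((1, 0), (l, 0))) ∨
    (b = (1, 0) ∧ (x + y = l ∧ 1 ≤ y) ∧ Rmat l ((x, y), b) = ((0, 1), (x + 1, y - 1))) ∨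
    (b = (1, 0) ∧ (x + y = l - 1) ∧ Rmat l ((x, y), b) = ((0, 0), (x + 1, y))) ∨
    (b = (1, 0) ∧ (x + y ≤ l - 2) ∧ Rmat l ((x, y), b) = ((1, 0), (x + 1, y + 1))) ∨
    (b = (0, 0) ∧ (x = l ∧ y = 0) ∧ Rmat l ((x, y), b) = ((1, 0), (l - 1, 0))) ∨
    (b = (0, 0) ∧ (x + y = l ∧ 1 ≤ y) ∧ Rmat l ((x, y), b) = ((0, 1), (x, y - 1))) ∨
    (b = (0, 0) ∧ (x + y ≤ l - 1) ∧ Rmat l ((x, y), b) = ((0, 0), (x, y))) ∨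
    (b = (0, 1) ∧ (x = 0 ∧ y = l) ∧ Rmat l ((x, y), b) = ((0, 1), (0, l))) ∨
    (b = (0, 1) ∧ (x = 0 ∧ y = l - 1) ∧ Rmat l ((x, y), b) = ((0, 0), (0, l))) ∨
    (b = (0, 1) ∧ (x = 1 ∧ y = 0) ∧ Rmat l ((x, y), b) = ((1, 0), (0, 1))) ∨
    (b = (0, 1) ∧ (y = 0 ∧ 2 ≤ x) ∧ Rmat l ((x, y), b) = ((1, 0), (x - 2, y))) ∨
    (b = (0, 1) ∧ (x = 0 ∧ y ≤ l - 2) ∧ Rmat l ((x, y), b) = ((1, 0), (x, y + 2))) ∨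
    (b = (0, 1) ∧ (1 ≤ x ∧ 1 ≤ y) ∧ Rmat l ((x, y), b) = ((0, 1), (x - 1, y - 1))) := by
  rcases memB_one b h2 with rfl | rfl | rfl
  all_goals
    simp only [memB] at h1
    generalize hR : Rmat l _ = r
    simp [Rmat, one, two, three] at hR
    split_ifs at hR <;> subst hR <;> simp <;> omega

theorem Rmat_maps (l : ℤ) (hl : 1 ≤ l) (p : (ℤ × ℤ) × (ℤ × ℤ)) (h1 : memB l p.1)
    (h2 : memB 1 p.2) : memB 1 (Rmat l p).1 ∧ memB l (Rmat l p).2 := by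
  obtain ⟨⟨x, y⟩, b⟩ := p
  have h := Rmat_cases l x y b hl h1 h2
  rcases h with h | h | h | h | h | h | h | h | h | h | h | h | h <;>
  · obtain ⟨rfl, hc, hR⟩ := h
    rw [hR]
    simp only [memB] at *
    omega

theorem Rmat_inj (l : ℤ) (hl : 1 ≤ l) (p q : (ℤ × ℤ) × (ℤ × ℤ)) (h1 : memB l p.1)
    (h2 : memB 1 p.2) (h3 : memB l q.1) (h4 : memB 1 q.2) (h : Rmat l p = Rmat l q) : p = q := by
  obtain ⟨⟨x, y⟩, b⟩ := p
  obtain ⟨⟨x', y'⟩, b'⟩ := q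
  have hp := Rmat_cases l x y b hl h1 h2
  have hq := Rmat_cases l x' y' b' hl h3 h4
  rcases hp with hp | hp | hp | hp | hp | hp | hp | hp | hp | hp | hp | hp | hp <;>
  · obtain ⟨rfl, hc, hR⟩ := hp
    rw [hR] at h
    clear hR
    rcases hq with hq | hq | hq | hq | hq | hq | hq | hq | hq | hq | hq | hq | hq <;>
    · obtain ⟨rfl, hc', hR⟩ := hq
      rw [hR] at h
      clear hR
      simp only [memB, Prod.mk.injEq, and_true] at *
      omega

set_option maxHeartbeats 4000000 in
theorem Rmat_e (l : ℤ) (hl : 1 ≤ l) (p : (ℤ × ℤ) × (ℤ × ℤ)) (h1 : memB l p.1)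
    (h2 : memB 1 p.2) (i : ℕ) (hi : i = 0 ∨ i = 1) :
    teop 1 l i (Rmat l p) = (teop l 1 i p).map (Rmat l) := by
  have hm := Rmat_maps l hl p h1 h2
  obtain ⟨⟨x, y⟩, b⟩ := p
  have h := Rmat_cases l x y b hl h1 h2
  rw [teop_eq _ _ _ _ _ h1 h2]
  rcases hi with rfl | rfl <;>
  rcases h with h | h | h | h | h | h | h | h | h | h | h | h | h <;>
  · obtain ⟨rfl, hc, hR⟩ := h
    rw [hR] at hm ⊢
    clear hR
    rw [teop_eq _ _ _ _ _ hm.1 hm.2]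
    simp [memB, gE, gF, eraw] at h1 ⊢
    clear hm h2
    first
    | omega
    | (refine ⟨by omega, ?_⟩; simp [Rmat, one, two, three]; grind)
    | split_ifs <;> first
      | rfl
      | (exfalso; omega)
      | (simp [Rmat, one, two, three]; done)
      | (simp [Rmat, one, two, three]; omega)
      | (simp [Rmat, one, two, three]; split_ifs <;> simp <;> omega)

set_option maxHeartbeats 4000000 in
theorem Rmat_f (l : ℤ) (hl : 1 ≤ l) (p : (ℤ × ℤ) × (ℤ × ℤ)) (h1 : memB l p.1)
    (h2 : memB 1 p.2) (i : ℕ) (hi : i = 0 ∨ i = 1) :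
    tfop 1 l i (Rmat l p) = (tfop l 1 i p).map (Rmat l) := by
  have hm := Rmat_maps l hl p h1 h2
  obtain ⟨⟨x, y⟩, b⟩ := p
  have h := Rmat_cases l x y b hl h1 h2
  rw [tfop_eq _ _ _ _ _ h1 h2]
  rcases hi with rfl | rfl <;>
  rcases h with h | h | h | h | h | h | h | h | h | h | h | h | h <;>
  · obtain ⟨rfl, hc, hR⟩ := h
    rw [hR] at hm ⊢
    clear hR
    rw [tfop_eq _ _ _ _ _ hm.1 hm.2]
    simp [memB, gE, gF, fraw] at h1 ⊢
    clear hm h2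
    first
    | omega
    | (refine ⟨by omega, ?_⟩; simp [Rmat, one, two, three]; grind)
    | split_ifs <;> first
      | rfl
      | (exfalso; omega)
      | (simp [Rmat, one, two, three]; done)
      | (simp [Rmat, one, two, three]; omega)
      | (simp [Rmat, one, two, three]; split_ifs <;> simp <;> omega)

theorem Rmat_iso (l : ℤ) (hl : 1 ≤ l) : IsCrystalIso l (Rmat l) := by
  refine ⟨?_, ?_⟩
  · have hinj : Set.InjOn (Rmat l) {p | memB l p.1 ∧ memB 1 p.2} :=
      fun p hp q hq h => Rmat_inj l hl p q hp.1 hp.2 hq.1 hq.2 h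
    refine ⟨fun p hp => Rmat_maps l hl p hp.1 hp.2, hinj, ?_⟩
    have hfin : Set.Finite {p : (ℤ × ℤ) × (ℤ × ℤ) | memB l p.1 ∧ memB 1 p.2} := by
      refine Set.Finite.subset (Set.finite_Icc (((0, 0), (0, 0)) : (ℤ × ℤ) × (ℤ × ℤ))
        ((l, l), (1, 1))) ?_
      rintro ⟨⟨x, y⟩, ⟨z, w⟩⟩ ⟨h1, h2⟩
      simp only [memB] at h1 h2
      simp only [Set.mem_Icc, Prod.mk_le_mk]
      omega
    have hmaps : Set.MapsTo (fun p => (Rmat l p).swap) {p | memB l p.1 ∧ memB 1 p.2}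
        {p | memB l p.1 ∧ memB 1 p.2} := fun p hp =>
      ⟨(Rmat_maps l hl p hp.1 hp.2).2, (Rmat_maps l hl p hp.1 hp.2).1⟩
    have hinj' : Set.InjOn (fun p => (Rmat l p).swap) {p | memB l p.1 ∧ memB 1 p.2} :=
      fun p hp q hq h => hinj hp hq (Prod.swap_injective h)
    have hsurj := (hfin.injOn_iff_bijOn_of_mapsTo hmaps).1 hinj'
    rintro q ⟨h1, h2⟩
    obtain ⟨p, hp, hpq⟩ := hsurj.surjOn (show q.swap ∈ _ from ⟨h2, h1⟩)
    exact ⟨p, hp, Prod.swap_injective hpq⟩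
  · rintro p ⟨h1, h2⟩ i hi
    rw [Rmat_e l hl p h1 h2 i hi, Rmat_f l hl p h1 h2 i hi]
    refine ⟨by simp, fun q hq => by simp [hq], by simp, fun q hq => by simp [hq]⟩

/-- The function `φ_1` on `B_1 ⊗ B_l`. -/
def psi (c : (ℤ × ℤ) × (ℤ × ℤ)) : ℤ := c.2.1 + max 0 (c.1.1 - c.2.2)

theorem psi_step (l : ℤ) (c d : (ℤ × ℤ) × (ℤ × ℤ)) (h1 : memB 1 c.1) (h2 : memB l c.2)
    (h : tfop 1 l 1 c = some d) : psi d = psi c - 1 ∧ 1 ≤ psi c := by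
  obtain ⟨⟨x, y⟩, ⟨z, w⟩⟩ := c
  rw [tfop_eq _ _ _ _ _ h1 h2] at h
  simp [memB, gE, gF, fraw] at h h1 h2
  split_ifs at h <;> simp at h <;> subst h <;> simp only [psi] <;> omega

/-- Moving along an `f̃_i` arrow of `B_l ⊗ B_1`. -/
theorem f_arrow (l : ℤ) (i : ℕ) (a b : ℤ × ℤ) (q : (ℤ × ℤ) × (ℤ × ℤ)) (h1 : memB l a)
    (h2 : memB 1 b)
    (h : (gE 1 i b < gF l i a ∧ memB l (fraw i a) ∧ q = (fraw i a, b)) ∨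
      (gF l i a ≤ gE 1 i b ∧ memB 1 (fraw i b) ∧ q = (a, fraw i b))) :
    tfop l 1 i (a, b) = some q := by
  rw [tfop_eq _ _ _ _ _ h1 h2]
  rcases h with ⟨h, h', rfl⟩ | ⟨h, h', rfl⟩
  · rw [if_pos h, if_pos h']
  · rw [if_neg (not_lt.2 h), if_pos h']

/-- Moving along an `ẽ_i` arrow of `B_l ⊗ B_1`. -/
theorem e_arrow (l : ℤ) (i : ℕ) (a b : ℤ × ℤ) (q : (ℤ × ℤ) × (ℤ × ℤ)) (h1 : memB l a)
    (h2 : memB 1 b)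
    (h : (gE 1 i b ≤ gF l i a ∧ memB l (eraw i a) ∧ q = (eraw i a, b)) ∨
      (gF l i a < gE 1 i b ∧ memB 1 (eraw i b) ∧ q = (a, eraw i b))) :
    teop l 1 i (a, b) = some q := by
  rw [teop_eq _ _ _ _ _ h1 h2]
  rcases h with ⟨h, h', rfl⟩ | ⟨h, h', rfl⟩
  · rw [if_pos h, if_pos h']
  · rw [if_neg (not_le.2 h), if_pos h']

theorem anchor (l : ℤ) (hl : 1 ≤ l) (F : (ℤ × ℤ) × (ℤ × ℤ) → (ℤ × ℤ) × (ℤ × ℤ))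
    (hF : IsCrystalIso l F) : F ((l, 0), (1, 0)) = ((1, 0), (l, 0)) := by
  obtain ⟨⟨hmaps, -, -⟩, hF⟩ := hF
  have h10 : memB 1 (1, 0) := by simp [memB]
  have key : ∀ k : ℕ, (k : ℤ) ≤ l →
      psi (F ((l, 0), (1, 0))) = psi (F ((l - k, (k : ℤ)), (1, 0))) + k := by
    intro k
    induction k with
    | zero => simp
    | succ k ih =>
      intro hk
      push_cast at hk ⊢
      have hm : memB l (l - k, (k : ℤ)) := by simp only [memB]; omega
      have hs : tfop l 1 1 ((l - k, (k : ℤ)), (1, 0))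
          = some ((l - (k + 1), (k : ℤ) + 1), (1, 0)) := by
        apply f_arrow _ _ _ _ _ hm h10
        simp [memB, gE, gF, fraw]
        omega
      have h2 := (hF _ ⟨hm, h10⟩ 1 (Or.inr rfl)).2.2.2 _ hs
      have hT := hmaps (show ((l - k, (k : ℤ)), ((1 : ℤ), (0 : ℤ))) ∈ _ from ⟨hm, h10⟩)
      have := psi_step l _ _ hT.1 hT.2 h2
      have := ih (by omega)
      omega
  have hk := key l.toNat (by omega)
  rw [Int.toNat_of_nonneg (by omega), sub_self] at hk
  have hm : memB l (0, l) := by simp only [memB]; omega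
  have hs : tfop l 1 1 ((0, l), (1, 0)) = some ((0, l), (0, 1)) := by
    apply f_arrow _ _ _ _ _ hm h10
    simp [memB, gE, gF, fraw]
  have h2 := (hF _ ⟨hm, h10⟩ 1 (Or.inr rfl)).2.2.2 _ hs
  have hT := hmaps (show ((0, l), ((1 : ℤ), (0 : ℤ))) ∈ _ from ⟨hm, h10⟩)
  have h3 := psi_step l _ _ hT.1 hT.2 h2
  have hml : memB l (l, 0) := by simp only [memB]; omega
  have hT' := hmaps (show ((l, 0), ((1 : ℤ), (0 : ℤ))) ∈ _ from ⟨hml, h10⟩)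
  have h4 : l + 1 ≤ psi (F ((l, 0), (1, 0))) := by omega
  generalize F ((l, 0), (1, 0)) = c at hT' h4
  obtain ⟨⟨x, y⟩, ⟨z, w⟩⟩ := c
  obtain ⟨h5, h6⟩ := hT'
  simp only [memB] at h5 h6
  simp only [psi] at h4
  simp only [Prod.mk.injEq]
  omega

/-- Any set of points of `B_l ⊗ B_1` closed under arrows and containing `(l,0) ⊗ 1`
is everything. -/
theorem connected (l : ℤ) (hl : 1 ≤ l) (A : (ℤ × ℤ) × (ℤ × ℤ) → Prop)
    (h0 : A ((l, 0), (1, 0)))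
    (hf : ∀ i a b q, i = 0 ∨ i = 1 → memB l a → memB 1 b → A (a, b) →
      ((gE 1 i b < gF l i a ∧ memB l (fraw i a) ∧ q = (fraw i a, b)) ∨
      (gF l i a ≤ gE 1 i b ∧ memB 1 (fraw i b) ∧ q = (a, fraw i b))) → A q)
    (he : ∀ i a b q, i = 0 ∨ i = 1 → memB l a → memB 1 b → A (a, b) →
      ((gE 1 i b ≤ gF l i a ∧ memB l (eraw i a) ∧ q = (eraw i a, b)) ∨
      (gF l i a < gE 1 i b ∧ memB 1 (eraw i b) ∧ q = (a, eraw i b))) → A q)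
    (p : (ℤ × ℤ) × (ℤ × ℤ)) (h1 : memB l p.1) (h2 : memB 1 p.2) : A p := by
  have m1 : memB 1 (1, 0) := by simp [memB]
  have m2 : memB 1 (0, 0) := by simp [memB]
  have m3 : memB 1 (0, 1) := by simp [memB]
  have ml : memB l (l, 0) := by simp only [memB]; omega
  -- the corner `(l,0)` with each of the three letters
  have c2 : A ((l, 0), (0, 0)) := by
    apply he 0 _ _ _ (Or.inl rfl) ml m1 h0
    simp [memB, gE, gF, eraw]; grind
  have c3 : A ((l, 0), (0, 1)) := by
    apply he 0 _ _ _ (Or.inl rfl) ml m2 c2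
    simp [memB, gE, gF, eraw]; grind
  -- rows with letters 1 and 2
  have row1 : ∀ n : ℤ, n ≤ l → A ((n, 0), (1, 0)) → ∀ k : ℕ, (k : ℤ) ≤ n →
      A ((n - k, (k : ℤ)), (1, 0)) := by
    intro n hn hA k
    induction k with
    | zero => intro _; simpa using hA
    | succ k ih =>
      intro hk
      push_cast at hk ⊢
      apply hf 1 _ _ _ (Or.inr rfl) _ m1 (ih (by omega))
      · simp [memB, gE, gF, fraw]; omega
      · simp only [memB]; omega
  have row2 : ∀ n : ℤ, n ≤ l → A ((n, 0), (0, 0)) → ∀ k : ℕ, (k : ℤ) ≤ n →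
      A ((n - k, (k : ℤ)), (0, 0)) := by
    intro n hn hA k
    induction k with
    | zero => intro _; simpa using hA
    | succ k ih =>
      intro hk
      push_cast at hk ⊢
      apply hf 1 _ _ _ (Or.inr rfl) _ m2 (ih (by omega))
      · simp [memB, gE, gF, fraw]; omega
      · simp only [memB]; omega
  have row3 : ∀ n : ℤ, n ≤ l → A ((n, 0), (0, 1)) → ∀ k : ℕ, (k : ℤ) < n →
      A ((n - k, (k : ℤ)), (0, 1)) := by
    intro n hn hA k
    induction k with
    | zero => intro _; simpa using hA
    | succ k ih =>
      intro hk
      push_cast at hk ⊢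
      apply hf 1 _ _ _ (Or.inr rfl) _ m3 (ih (by omega))
      · simp [memB, gE, gF, fraw]; omega
      · simp only [memB]; omega
  -- the axis `y = 0` with letter 3
  have ax3 : ∀ k : ℕ, (k : ℤ) ≤ l → A ((l - k, 0), (0, 1)) := by
    intro k
    induction k with
    | zero => intro _; simpa using c3
    | succ k ih =>
      intro hk
      push_cast at hk ⊢
      apply he 0 _ _ _ (Or.inl rfl) _ m3 (ih (by omega))
      · simp [memB, gE, gF, eraw]; grind
      · simp only [memB]; omega
  have z3 : A ((0, 0), (0, 1)) := by
    have := ax3 l.toNat (by omega)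
    rwa [Int.toNat_of_nonneg (by omega), sub_self] at this
  have ay3 : ∀ k : ℕ, (k : ℤ) ≤ l → A ((0, (k : ℤ)), (0, 1)) := by
    intro k
    induction k with
    | zero => intro _; simpa using z3
    | succ k ih =>
      intro hk
      push_cast at hk ⊢
      apply he 0 _ _ _ (Or.inl rfl) _ m3 (ih (by omega))
      · simp [memB, gE, gF, eraw]; grind
      · simp only [memB]; omega
  -- letter 2
  have t2 : A ((0, l), (0, 0)) := by
    have := row2 l le_rfl c2 l.toNat (by omega)
    rwa [Int.toNat_of_nonneg (by omega), sub_self] at this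
  have ay2 : ∀ k : ℕ, (k : ℤ) ≤ l → A ((0, l - k), (0, 0)) := by
    intro k
    induction k with
    | zero => intro _; simpa using t2
    | succ k ih =>
      intro hk
      push_cast at hk ⊢
      apply hf 0 _ _ _ (Or.inl rfl) _ m2 (ih (by omega))
      · simp [memB, gE, gF, fraw]; grind
      · simp only [memB]; omega
  have z2 : A ((0, 0), (0, 0)) := by
    have := ay2 l.toNat (by omega)
    rwa [Int.toNat_of_nonneg (by omega), sub_self] at this
  have ax2 : ∀ k : ℕ, (k : ℤ) ≤ l - 1 → A (((k : ℤ), 0), (0, 0)) := by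
    intro k
    induction k with
    | zero => intro _; simpa using z2
    | succ k ih =>
      intro hk
      push_cast at hk ⊢
      apply hf 0 _ _ _ (Or.inl rfl) _ m2 (ih (by omega))
      · simp [memB, gE, gF, fraw]; grind
      · simp only [memB]; omega
  -- letter 1
  have z1 : A ((0, 0), (1, 0)) := by
    apply he 1 _ _ _ (Or.inr rfl) _ m3 z3
    · simp [memB, gE, gF, eraw]
    · simp only [memB]; omega
  have ax1 : ∀ k : ℕ, (k : ℤ) ≤ l - 2 → A (((k : ℤ), 0), (1, 0)) := by
    intro k
    induction k with
    | zero => intro _; simpa using z1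
    | succ k ih =>
      intro hk
      push_cast at hk ⊢
      apply hf 0 _ _ _ (Or.inl rfl) _ m1 (ih (by omega))
      · simp [memB, gE, gF, fraw]; grind
      · simp only [memB]; omega
  have d1 : A ((l - 1, 0), (1, 0)) := by
    have hA := ax2 (l - 1).toNat (by omega)
    rw [Int.toNat_of_nonneg (by omega)] at hA
    apply hf 0 _ _ _ (Or.inl rfl) _ m2 hA
    · simp [memB, gE, gF, fraw]; grind
    · simp only [memB]; omega
  -- conclusion
  obtain ⟨⟨x, y⟩, b⟩ := p
  simp only at h1 h2
  obtain ⟨hx, hy, hxy⟩ := h1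
  simp only at hx hy hxy
  lift y to ℕ using hy
  have hxe : x = (x + y) - y := by ring
  rcases memB_one b h2 with rfl | rfl | rfl
  · have hA : A ((x + y, 0), (1, 0)) := by
      by_cases h : x + y ≤ l - 2
      · have := ax1 (x + y).toNat (by omega)
        rwa [Int.toNat_of_nonneg (by omega)] at this
      · rcases (show x + y = l - 1 ∨ x + y = l by omega) with h | h <;> rw [h] <;> assumption
    have := row1 (x + y) hxy hA y (by omega)
    rwa [← hxe] at this
  · have hA : A ((x + y, 0), (0, 0)) := by
      by_cases h : x + y ≤ l - 1
      · have := ax2 (x + y).toNat (by omega)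
        rwa [Int.toNat_of_nonneg (by omega)] at this
      · rw [show x + y = l by omega]; assumption
    have := row2 (x + y) hxy hA y (by omega)
    rwa [← hxe] at this
  · by_cases h0x : x = 0
    · subst h0x
      exact ay3 y (by omega)
    · have hA := ax3 (l - (x + y)).toNat (by omega)
      rw [Int.toNat_of_nonneg (by omega), sub_sub_cancel] at hA
      have := row3 (x + y) hxy hA y (by omega)
      rwa [← hxe] at this

/-- There is exactly one bijection `B_l × B₁ → B₁ × B_l` intertwining the Kashiwara
operators, namely the map `R` given by the explicit case list. -/
theorem Rmat_unique_iso (l : ℤ) (hl : 1 ≤ l) :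
    IsCrystalIso l (Rmat l) ∧
    ∀ F : (ℤ × ℤ) × (ℤ × ℤ) → (ℤ × ℤ) × (ℤ × ℤ), IsCrystalIso l F →
      Set.EqOn F (Rmat l) {p | memB l p.1 ∧ memB 1 p.2} := by

  refine ⟨Rmat_iso l hl, fun F hF p hp => ?_⟩
  have hR := Rmat_iso l hl
  refine connected l hl (fun p => F p = Rmat l p) ?_ ?_ ?_ p hp.1 hp.2
  · rw [anchor l hl F hF, anchor l hl _ hR]
  · intro i a b q hi ha hb hA h
    have hq := f_arrow l i a b q ha hb h
    have h1 := (hF.2 (a, b) ⟨ha, hb⟩ i hi).2.2.2 q hq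
    have h2 := (hR.2 (a, b) ⟨ha, hb⟩ i hi).2.2.2 q hq
    rw [hA, h2] at h1
    exact (Option.some.inj h1).symm
  · intro i a b q hi ha hb hA h
    have hq := e_arrow l i a b q ha hb h
    have h1 := (hF.2 (a, b) ⟨ha, hb⟩ i hi).2.1 q hq
    have h2 := (hR.2 (a, b) ⟨ha, hb⟩ i hi).2.1 q hq
    rw [hA, h2] at h1
    exact (Option.some.inj h1).symm
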